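/- Let Γ be a smooth solution of the Yang–Mills flow on ℝⁿ × [0,T) such that there is a compact set K ⊂ ℝⁿ with supp Γ_t ⊆ K for every t. Then for every z₀ = (x₀,t₀) with t₀ ∈ (0,T) and all 0 < ρ ≤ r < √t₀/2 one has Φ_{z₀}(ρ;Γ) ≤ Φ_{z₀}(r;Γ). -/

import Mathlib

open MeasureTheory Filter Set
open scoped ContDiff ENNReal

noncomputable section

abbrev Mat (k : ℕ) := Fin k → Fin k → ℝ

def mmul {k : ℕ} (A B : Mat k) : Mat k := fun i j => ∑ l, A i l * B l j

def mbra {k : ℕ} (A B : Mat k) : Mat k := mmul A B - mmul B A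

def minner {k : ℕ} (A B : Mat k) : ℝ := ∑ i, ∑ j, A i j * B i j

def msq {k : ℕ} (A : Mat k) : ℝ := minner A A

abbrev Conn (n k : ℕ) := ℝ → (Fin n → ℝ) → Fin n → Mat k

/-- Spatial partial derivative in the `i`-th coordinate direction. -/
def pd {n : ℕ} {E : Type*} [NormedAddCommGroup E] [NormedSpace ℝ E]
    (f : (Fin n → ℝ) → E) (x : Fin n → ℝ) (i : Fin n) : E :=
  fderiv ℝ f x (Pi.single i 1)

/-- Time derivative of a time-dependent connection. -/
def tderiv {n k : ℕ} (Γ : Conn n k) (t : ℝ) (x : Fin n → ℝ) (j : Fin n) : Mat k :=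
  deriv (fun s => Γ s x j) t

/-- Curvature `(F_t)_{ij} = ∂_i(Γ_t)_j − ∂_j(Γ_t)_i + [(Γ_t)_i,(Γ_t)_j]`. -/
def curv {n k : ℕ} (Γ : Conn n k) (t : ℝ) (x : Fin n → ℝ) (i j : Fin n) : Mat k :=
  pd (fun y => Γ t y j) x i - pd (fun y => Γ t y i) x j + mbra (Γ t x i) (Γ t x j)

/-- Covariant derivative `∇_i om = ∂_i om + [(Γ_t)_i, om]`. -/
def covD {n k : ℕ} (Γ : Conn n k) (t : ℝ) (om : (Fin n → ℝ) → Mat k)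
    (x : Fin n → ℝ) (i : Fin n) : Mat k :=
  pd om x i + mbra (Γ t x i) (om x)

/-- A smooth time-dependent connection: jointly smooth in `(t,x)`, with values in the
skew-symmetric matrices `𝔤`. -/
def IsSmoothConn {n k : ℕ} (Γ : Conn n k) : Prop :=
  ContDiff ℝ ∞ (fun p : ℝ × (Fin n → ℝ) => Γ p.1 p.2)
    ∧ ∀ t x i a b, Γ t x i b a = - (Γ t x i a b)

/-- The Yang–Mills flow equation `∂_t(Γ_t)_j = Σᵢ ∇_i(F_t)_{ij}` on a time interval `I`. -/
def IsYMFlowOn {n k : ℕ} (Γ : Conn n k) (I : Set ℝ) : Prop :=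
  ∀ t ∈ I, ∀ x j, tderiv Γ t x j = ∑ i, covD Γ t (fun y => curv Γ t y i j) x i

/-- `|F_t|²(x) = Σ_{i,j} |(F_t)_{ij}(x)|²`. -/
def normF2 {n k : ℕ} (Γ : Conn n k) (t : ℝ) (x : Fin n → ℝ) : ℝ :=
  ∑ i, ∑ j, msq (curv Γ t x i j)

/-- The backwards heat kernel `G_{z₀}(x,t)` based at `z₀ = (x₀,t₀)`. -/
def gauss {n : ℕ} (z0 : (Fin n → ℝ) × ℝ) (x : Fin n → ℝ) (t : ℝ) : ℝ :=
  (4 * Real.pi * (z0.2 - t)) ^ (-(n : ℝ) / 2) *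
    Real.exp (-(∑ i, (x i - z0.1 i) ^ 2) / (4 * (z0.2 - t)))

/-- The entropy `Φ_{z₀}(R;Γ)`. -/
def Phi {n k : ℕ} (Γ : Conn n k) (z0 : (Fin n → ℝ) × ℝ) (R : ℝ) : ℝ :=
  R ^ 4 / 2 * ∫ x : Fin n → ℝ, normF2 Γ (z0.2 - R ^ 2) x * gauss z0 x (z0.2 - R ^ 2)

/-- The entropy `Ψ_{z₀}(R;Γ)`. -/
def Psi {n k : ℕ} (Γ : Conn n k) (z0 : (Fin n → ℝ) × ℝ) (R : ℝ) : ℝ :=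
  R ^ 2 / 2 * ∫ t in Icc (z0.2 - 4 * R ^ 2) (z0.2 - R ^ 2),
    ∫ x : Fin n → ℝ, normF2 Γ t x * gauss z0 x t

/-- The parabolically rescaled connection `Γ^{λ,z₀}`. -/
def rescale {n k : ℕ} (Γ : Conn n k) (z0 : (Fin n → ℝ) × ℝ) (lam : ℝ) : Conn n k :=
  fun t x i => lam • Γ (lam ^ 2 * t + z0.2) (fun m => lam * x m + z0.1 m) i

/-- Spatial support of `Γ_t` contained in `K` for all `t`. -/
def SuppIn {n k : ℕ} (Γ : Conn n k) (K : Set (Fin n → ℝ)) : Prop :=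
  ∀ t x, x ∉ K → Γ t x = 0

section Algebra

variable {k : ℕ}

lemma minner_comm (A B : Mat k) : minner A B = minner B A := by
  simp only [minner, mul_comm]

lemma minner_add_left (A B C : Mat k) : minner (A + B) C = minner A C + minner B C := by
  simp only [minner, Pi.add_apply, add_mul, Finset.sum_add_distrib]

lemma minner_smul_left (c : ℝ) (A B : Mat k) : minner (c • A) B = c * minner A B := by
  simp only [minner, Pi.smul_apply, smul_eq_mul, mul_assoc, Finset.mul_sum]

lemma minner_neg_left (A B : Mat k) : minner (-A) B = -minner A B := by
  simpa using minner_smul_left (-1) A B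

lemma minner_sub_left (A B C : Mat k) : minner (A - B) C = minner A C - minner B C := by
  rw [sub_eq_add_neg, minner_add_left, minner_neg_left, sub_eq_add_neg]

lemma minner_add_right (A B C : Mat k) : minner A (B + C) = minner A B + minner A C := by
  simp only [minner_comm A, minner_add_left]

lemma minner_smul_right (c : ℝ) (A B : Mat k) : minner A (c • B) = c * minner A B := by
  simp only [minner_comm A, minner_smul_left]

lemma minner_sub_right (A B C : Mat k) : minner A (B - C) = minner A B - minner A C := by
  simp only [minner_comm A, minner_sub_left]

lemma minner_zero_left (B : Mat k) : minner 0 B = 0 := by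
  simp [minner]

lemma minner_sum_left {ι : Type*} (s : Finset ι) (f : ι → Mat k) (B : Mat k) :
    minner (∑ i ∈ s, f i) B = ∑ i ∈ s, minner (f i) B := by
  classical
  induction s using Finset.induction_on with
  | empty => simp [minner_zero_left]
  | insert a s ha ih => rw [Finset.sum_insert ha, Finset.sum_insert ha, minner_add_left, ih]

lemma minner_sum_right {ι : Type*} (s : Finset ι) (f : ι → Mat k) (B : Mat k) :
    minner B (∑ i ∈ s, f i) = ∑ i ∈ s, minner B (f i) := by
  simp only [minner_comm B, minner_sum_left]

lemma msq_nonneg (A : Mat k) : 0 ≤ msq A := by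
  unfold msq minner
  exact Finset.sum_nonneg fun _ _ => Finset.sum_nonneg fun _ _ => mul_self_nonneg _

/-- The bracket of `Mat k` is the commutator of matrices. -/
lemma mbra_eq_commutator (A B : Mat k) :
    mbra A B = (Matrix.of A * Matrix.of B - Matrix.of B * Matrix.of A : Matrix _ _ ℝ) := by
  ext i j
  simp [mbra, mmul, Matrix.mul_apply]

lemma mbra_skew (A B : Mat k) : mbra A B = -mbra B A := by
  simp [mbra]

lemma mbra_zero_right (A : Mat k) : mbra A 0 = 0 := by
  ext; simp [mbra, mmul]

lemma mbra_add_right (A B C : Mat k) : mbra A (B + C) = mbra A B + mbra A C := by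
  ext i j
  simp only [mbra, mmul, Pi.add_apply, Pi.sub_apply, mul_add, add_mul, Finset.sum_add_distrib]
  ring

lemma mbra_neg_right (A B : Mat k) : mbra A (-B) = -mbra A B := by
  rw [eq_neg_iff_add_eq_zero, ← mbra_add_right, neg_add_cancel, mbra_zero_right]

lemma mbra_sub_right (A B C : Mat k) : mbra A (B - C) = mbra A B - mbra A C := by
  rw [sub_eq_add_neg, mbra_add_right, mbra_neg_right, sub_eq_add_neg]

lemma mbra_jacobi (A B C : Mat k) :
    mbra A (mbra B C) + mbra B (mbra C A) + mbra C (mbra A B) = 0 := by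
  have h : ∀ X Y Z : Matrix (Fin k) (Fin k) ℝ,
      (X * (Y * Z - Z * Y) - (Y * Z - Z * Y) * X) + (Y * (Z * X - X * Z) - (Z * X - X * Z) * Y)
        + (Z * (X * Y - Y * X) - (X * Y - Y * X) * Z) = 0 := by
    intro X Y Z
    noncomm_ring
  simp only [mbra_eq_commutator]
  exact h A B C

/-- The inner product is invariant under the adjoint action of a skew-symmetric matrix. -/
lemma minner_mbra (A B C : Mat k) (hA : ∀ a b, A b a = -A a b) :
    minner (mbra A B) C + minner B (mbra A C) = 0 := by
  have h : ∀ X Y Z : Mat k, minner X (mmul Y Z) = ∑ i, ∑ j, ∑ l, X i j * Y i l * Z l j := by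
    intro X Y Z
    simp only [minner, mmul, Finset.mul_sum, mul_assoc]
  simp only [mbra, minner_sub_left, minner_sub_right]
  rw [minner_comm (mmul A B), minner_comm (mmul B A)]
  simp only [h]
  have e1 : ∑ i, ∑ j, ∑ l, C i j * A i l * B l j = -∑ i, ∑ j, ∑ l, B i j * A i l * C l j := by
    simp only [← Finset.sum_neg_distrib]
    rw [Finset.sum_congr rfl fun i _ => Finset.sum_comm, Finset.sum_comm]
    refine Finset.sum_congr rfl fun i _ => ?_
    rw [Finset.sum_comm]
    refine Finset.sum_congr rfl fun j _ => Finset.sum_congr rfl fun l _ => ?_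
    rw [hA i l]; ring
  have e2 : ∑ i, ∑ j, ∑ l, C i j * B i l * A l j = -∑ i, ∑ j, ∑ l, B i j * C i l * A l j := by
    simp only [← Finset.sum_neg_distrib]
    refine Finset.sum_congr rfl fun i _ => ?_
    rw [Finset.sum_comm]
    refine Finset.sum_congr rfl fun j _ => Finset.sum_congr rfl fun l _ => ?_
    rw [hA l j]; ring
  rw [e1, e2]; ring

lemma sum_minner_antisymm {n : ℕ} (F P : Fin n → Fin n → Mat k) (hF : ∀ i j, F j i = -F i j) :
    ∑ i, ∑ j, minner (F i j) (P i j - P j i) = 2 * ∑ i, ∑ j, minner (F i j) (P i j) := by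
  have h : ∑ i, ∑ j, minner (F i j) (P j i) = -∑ i, ∑ j, minner (F i j) (P i j) := by
    rw [Finset.sum_comm]
    simp only [← Finset.sum_neg_distrib, ← minner_neg_left, ← hF]
  simp only [minner_sub_right, Finset.sum_sub_distrib, h]
  ring

lemma sum_minner_bianchi {n : ℕ} (F : Fin n → Fin n → Mat k) (N : Fin n → Fin n → Fin n → Mat k)
    (hF : ∀ i j, F j i = -F i j) (hN : ∀ m i j, N m j i = -N m i j)
    (hB : ∀ m i j, N m i j + N i j m + N j m i = 0) (m : Fin n) :
    ∑ i, ∑ j, minner (N m i j) (F i j) = 2 * ∑ i, ∑ j, minner (N i m j) (F i j) := by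
  have h : ∀ i j, minner (N m i j) (F i j) = minner (F i j) (N i m j - N j m i) := by
    intro i j
    rw [minner_comm]
    congr 1
    rw [← sub_eq_zero, ← hB m i j, hN i m j]
    abel
  simp only [h]
  rw [sum_minner_antisymm F (fun i j => N i m j) hF]
  simp only [minner_comm]

/-- The pointwise identity behind the monotonicity: the time derivative of the weighted energy
density is a divergence minus a square. -/
lemma energy_density_identity {n : ℕ} (F P : Fin n → Fin n → Mat k)
    (N : Fin n → Fin n → Fin n → Mat k) (D : Fin n → Mat k) (y : Fin n → ℝ) (s : ℝ) (hs : s ≠ 0)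
    (hF : ∀ i j, F j i = -F i j) (hN : ∀ m i j, N m j i = -N m i j)
    (hB : ∀ m i j, N m i j + N i j m + N j m i = 0) (hD : ∀ j, D j = ∑ i, N i i j) :
    (-2 * s * (∑ i, ∑ j, msq (F i j)) + s ^ 2 * (2 * ∑ i, ∑ j, minner (F i j) (P i j - P j i)
        + (∑ i, ∑ j, msq (F i j)) * (n / (2 * s) - (∑ i, y i ^ 2) / (4 * s ^ 2)))) =
      (∑ i, (4 * s ^ 2 * (∑ j, (minner (N i i j) (D j) + minner (F i j) (P i j)))
          + s / 2 * (∑ a, ∑ b, msq (F a b)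
            + y i * ∑ a, ∑ b, 2 * minner (N i a b) (F a b))
          - 2 * s * (∑ j, msq (F i j)
            + ∑ m, y m * ∑ j, (minner (N i m j) (F i j) + minner (F m j) (N i i j)))
          - y i / (2 * s) * (4 * s ^ 2 * (∑ j, minner (F i j) (D j))
            + s / 2 * (y i * ∑ a, ∑ b, msq (F a b))
            - 2 * s * ∑ m, y m * ∑ j, minner (F m j) (F i j))))
        - s ^ 2 * ∑ j, msq ((2 : ℝ) • D j - s⁻¹ • ∑ i, y i • F i j) := by
  have hDD : ∑ i, ∑ j, minner (N i i j) (D j) = ∑ j, minner (D j) (D j) := by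
    rw [Finset.sum_comm]
    refine Finset.sum_congr rfl fun j _ => ?_
    rw [← minner_sum_left, ← hD]
  have hFD : ∑ i, ∑ m, y m * ∑ j, minner (F m j) (N i i j) = ∑ i, y i * ∑ j, minner (F i j) (D j) := by
    rw [Finset.sum_comm]
    refine Finset.sum_congr rfl fun m _ => ?_
    rw [← Finset.mul_sum, Finset.sum_comm]
    simp only [← minner_sum_right, ← hD]
  have hBi : ∑ i, y i * ∑ a, ∑ b, minner (N i a b) (F a b)
      = 2 * ∑ i, ∑ m, y m * ∑ j, minner (N i m j) (F i j) := by
    rw [Finset.sum_comm (f := fun i m => y m * ∑ j, minner (N i m j) (F i j)), Finset.mul_sum]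
    refine Finset.sum_congr rfl fun m _ => ?_
    rw [sum_minner_bianchi F N hF hN hB m, ← Finset.mul_sum]
    ring
  have hXD : ∑ j, minner (∑ i, y i • F i j) (D j) = ∑ i, y i * ∑ j, minner (F i j) (D j) := by
    simp only [minner_sum_left, minner_smul_left, Finset.mul_sum]
    rw [Finset.sum_comm]
  have hXX : ∑ j, minner (∑ i, y i • F i j) (∑ i, y i • F i j)
      = ∑ i, y i * ∑ m, y m * ∑ j, minner (F m j) (F i j) := by
    simp only [minner_sum_left, minner_sum_right, minner_smul_left, minner_smul_right,
      Finset.mul_sum]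
    rw [Finset.sum_comm]
    conv_rhs => rw [Finset.sum_comm]
    refine Finset.sum_congr rfl fun i _ => ?_
    rw [Finset.sum_comm]
    exact Finset.sum_congr rfl fun j _ => Finset.sum_congr rfl fun l _ => by
      rw [minner_comm (F i l)]; ring
  have hsq : ∑ j, msq ((2 : ℝ) • D j - s⁻¹ • ∑ i, y i • F i j)
      = 4 * ∑ j, minner (D j) (D j) - 4 * s⁻¹ * ∑ j, minner (∑ i, y i • F i j) (D j)
        + s⁻¹ ^ 2 * ∑ j, minner (∑ i, y i • F i j) (∑ i, y i • F i j) := by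
    simp only [Finset.mul_sum, ← Finset.sum_sub_distrib, ← Finset.sum_add_distrib]
    refine Finset.sum_congr rfl fun j _ => ?_
    simp only [msq, minner_sub_left, minner_sub_right, minner_smul_left, minner_smul_right]
    rw [minner_comm (D j) (∑ i, y i • F i j)]
    ring
  rw [hsq, hXD, hXX, sum_minner_antisymm F P hF]
  have hsum : ∀ u v w : Fin n → ℝ, ∀ c : ℝ, ∑ i, y i / (2 * s) * (4 * s ^ 2 * u i
      + s / 2 * (y i * c) - 2 * s * w i) =
      2 * s * ∑ i, y i * u i + c * (∑ i, y i ^ 2) / 4 - ∑ i, y i * w i := by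
    intro u v w c
    simp only [Finset.mul_sum, Finset.sum_div, ← Finset.sum_sub_distrib, ← Finset.sum_add_distrib]
    refine Finset.sum_congr rfl fun i _ => ?_
    field_simp
    ring
  rw [Finset.sum_sub_distrib, hsum _ 0]
  simp only [Finset.sum_sub_distrib, Finset.sum_add_distrib, ← Finset.mul_sum, mul_add, hDD, hFD]
  simp only [mul_left_comm _ (2 : ℝ), ← Finset.mul_sum, hBi]
  simp only [Finset.sum_const, Finset.card_univ, Fintype.card_fin, nsmul_eq_mul]
  field_simp
  ring

end Algebra

section Calculus

variable {n k : ℕ}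

/-- Derivative in the direction `v` on spacetime. -/
def dirD {E : Type*} [NormedAddCommGroup E] [NormedSpace ℝ E]
    (v : ℝ × (Fin n → ℝ)) (f : ℝ × (Fin n → ℝ) → E) (p : ℝ × (Fin n → ℝ)) : E :=
  fderiv ℝ f p v

/-- The unit time direction of spacetime. -/
def timeDir (n : ℕ) : ℝ × (Fin n → ℝ) := (1, 0)

/-- The `i`-th spatial coordinate direction of spacetime. -/
def spaceDir (i : Fin n) : ℝ × (Fin n → ℝ) := (0, Pi.single i 1)

section General

variable {E : Type*} [NormedAddCommGroup E] [NormedSpace ℝ E]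

lemma contDiff_dirD {f : ℝ × (Fin n → ℝ) → E} (hf : ContDiff ℝ ∞ f) (v : ℝ × (Fin n → ℝ)) :
    ContDiff ℝ ∞ (dirD v f) :=
  (hf.fderiv_right (m := ∞) (by simp)).clm_apply contDiff_const

lemma hasDerivAt_line {f : ℝ × (Fin n → ℝ) → E} (hf : ContDiff ℝ ∞ f) (v p : ℝ × (Fin n → ℝ)) :
    HasDerivAt (fun τ : ℝ => f (p + τ • v)) (dirD v f p) 0 :=
  ((hf.differentiable (by simp)) p).hasFDerivAt.hasLineDerivAt v

lemma dirD_comm {f : ℝ × (Fin n → ℝ) → E} (hf : ContDiff ℝ ∞ f) (v w p : ℝ × (Fin n → ℝ)) :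
    dirD v (dirD w f) p = dirD w (dirD v f) p := by
  have hd : DifferentiableAt ℝ (fderiv ℝ f) p :=
    (hf.fderiv_right (m := ∞) (by simp)).differentiable (by simp) p
  have h : ∀ a b, dirD a (dirD b f) p = fderiv ℝ (fderiv ℝ f) p a b := by
    intro a b
    have h1 := (hd.hasFDerivAt.clm_apply (hasFDerivAt_const b p)).fderiv
    have h2 := congrArg (fun L => L a) h1
    change fderiv ℝ (fun y => fderiv ℝ f y b) p a = _
    simpa using h2
  rw [h, h]
  exact (hf.contDiffAt.isSymmSndFDerivAt (by
    simp only [minSmoothness_of_isRCLikeNormedField]; exact ENat.LEInfty.out)) v w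

lemma hasFDerivAt_prodMk_left_slice {f : ℝ × (Fin n → ℝ) → E} (hf : ContDiff ℝ ∞ f) (t : ℝ)
    (x : Fin n → ℝ) :
    HasFDerivAt (fun y => f (t, y)) ((fderiv ℝ f (t, x)).comp (.inr ℝ ℝ (Fin n → ℝ))) x :=
  ((hf.differentiable (by simp) (t, x)).hasFDerivAt).comp x (hasFDerivAt_prodMk_right t x)

lemma pd_slice {f : ℝ × (Fin n → ℝ) → E} (hf : ContDiff ℝ ∞ f) (t : ℝ) (x : Fin n → ℝ)
    (i : Fin n) : pd (fun y => f (t, y)) x i = dirD (spaceDir i) f (t, x) := by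
  rw [pd, (hasFDerivAt_prodMk_left_slice hf t x).fderiv]
  simp [dirD, spaceDir]

lemma hasDerivAt_time {f : ℝ × (Fin n → ℝ) → E} (hf : ContDiff ℝ ∞ f) (t : ℝ)
    (x : Fin n → ℝ) : HasDerivAt (fun s => f (s, x)) (dirD (timeDir n) f (t, x)) t :=
  ((hf.differentiable (by simp) (t, x)).hasFDerivAt).comp_hasDerivAt t
    ((hasDerivAt_id t).prodMk (hasDerivAt_const t x))

lemma hasDerivAt_space {f : ℝ × (Fin n → ℝ) → E} (hf : ContDiff ℝ ∞ f) (t : ℝ)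
    (x : Fin n → ℝ) (i : Fin n) :
    HasDerivAt (fun τ : ℝ => f (t, x + τ • Pi.single i 1)) (dirD (spaceDir i) f (t, x)) 0 := by
  simpa [spaceDir] using hasDerivAt_line hf (spaceDir i) (t, x)

end General

lemma contDiff_minner {f g : ℝ × (Fin n → ℝ) → Mat k} (hf : ContDiff ℝ ∞ f)
    (hg : ContDiff ℝ ∞ g) : ContDiff ℝ ∞ (fun p => minner (f p) (g p)) := by
  unfold minner
  fun_prop

lemma contDiff_mbra {f g : ℝ × (Fin n → ℝ) → Mat k} (hf : ContDiff ℝ ∞ f)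
    (hg : ContDiff ℝ ∞ g) : ContDiff ℝ ∞ (fun p => mbra (f p) (g p)) := by
  have h : ∀ u v : ℝ × (Fin n → ℝ) → Mat k, ContDiff ℝ ∞ u → ContDiff ℝ ∞ v →
      ContDiff ℝ ∞ (fun p => mmul (u p) (v p)) := by
    intro u v hu hv
    refine contDiff_pi.2 fun i => contDiff_pi.2 fun j => ?_
    unfold mmul
    fun_prop
  exact (h f g hf hg).sub (h g f hg hf)

lemma HasDerivAt.minner {f g : ℝ → Mat k} {f' g' : Mat k} {t : ℝ} (hf : HasDerivAt f f' t)
    (hg : HasDerivAt g g' t) :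
    HasDerivAt (fun τ => minner (f τ) (g τ)) (minner f' (g t) + minner (f t) g') t := by
  have hf' : ∀ i j, HasDerivAt (fun τ => f τ i j) (f' i j) t := fun i j =>
    hasDerivAt_pi.1 (hasDerivAt_pi.1 hf i) j
  have hg' : ∀ i j, HasDerivAt (fun τ => g τ i j) (g' i j) t := fun i j =>
    hasDerivAt_pi.1 (hasDerivAt_pi.1 hg i) j
  unfold _root_.minner
  simp only [← Finset.sum_add_distrib]
  exact HasDerivAt.fun_sum fun i _ => HasDerivAt.fun_sum fun j _ => (hf' i j).mul (hg' i j)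

lemma HasDerivAt.mmul {f g : ℝ → Mat k} {f' g' : Mat k} {t : ℝ} (hf : HasDerivAt f f' t)
    (hg : HasDerivAt g g' t) :
    HasDerivAt (fun τ => mmul (f τ) (g τ)) (mmul f' (g t) + mmul (f t) g') t := by
  have hf' : ∀ i j, HasDerivAt (fun τ => f τ i j) (f' i j) t := fun i j =>
    hasDerivAt_pi.1 (hasDerivAt_pi.1 hf i) j
  have hg' : ∀ i j, HasDerivAt (fun τ => g τ i j) (g' i j) t := fun i j =>
    hasDerivAt_pi.1 (hasDerivAt_pi.1 hg i) j
  refine hasDerivAt_pi.2 fun i => hasDerivAt_pi.2 fun j => ?_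
  simp only [_root_.mmul, Pi.add_apply, ← Finset.sum_add_distrib]
  exact HasDerivAt.fun_sum fun l _ => (hf' i l).mul (hg' l j)

lemma HasDerivAt.mbra {f g : ℝ → Mat k} {f' g' : Mat k} {t : ℝ} (hf : HasDerivAt f f' t)
    (hg : HasDerivAt g g' t) :
    HasDerivAt (fun τ => mbra (f τ) (g τ)) (mbra f' (g t) + mbra (f t) g') t := by
  refine ((hf.mmul hg).sub (hg.mmul hf)).congr_deriv ?_
  simp only [_root_.mbra]
  abel

lemma dirD_mbra {f g : ℝ × (Fin n → ℝ) → Mat k} (hf : ContDiff ℝ ∞ f) (hg : ContDiff ℝ ∞ g)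
    (v p : ℝ × (Fin n → ℝ)) :
    dirD v (fun q => mbra (f q) (g q)) p = mbra (dirD v f p) (g p) + mbra (f p) (dirD v g p) := by
  have h := (hasDerivAt_line hf v p).mbra (hasDerivAt_line hg v p)
  simp only [zero_smul, add_zero] at h
  exact (hasDerivAt_line (contDiff_mbra hf hg) v p).unique h

lemma dirD_minner {f g : ℝ × (Fin n → ℝ) → Mat k} (hf : ContDiff ℝ ∞ f) (hg : ContDiff ℝ ∞ g)
    (v p : ℝ × (Fin n → ℝ)) :
    dirD v (fun q => minner (f q) (g q)) p =
      minner (dirD v f p) (g p) + minner (f p) (dirD v g p) := by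
  have h := (hasDerivAt_line hf v p).minner (hasDerivAt_line hg v p)
  simp only [zero_smul, add_zero] at h
  exact (hasDerivAt_line (contDiff_minner hf hg) v p).unique h

lemma dirD_add {f g : ℝ × (Fin n → ℝ) → Mat k} (hf : ContDiff ℝ ∞ f) (hg : ContDiff ℝ ∞ g)
    (v p : ℝ × (Fin n → ℝ)) :
    dirD v (fun q => f q + g q) p = dirD v f p + dirD v g p :=
  (hasDerivAt_line (hf.add hg) v p).unique ((hasDerivAt_line hf v p).add (hasDerivAt_line hg v p))

lemma dirD_sub {f g : ℝ × (Fin n → ℝ) → Mat k} (hf : ContDiff ℝ ∞ f) (hg : ContDiff ℝ ∞ g)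
    (v p : ℝ × (Fin n → ℝ)) :
    dirD v (fun q => f q - g q) p = dirD v f p - dirD v g p :=
  (hasDerivAt_line (hf.sub hg) v p).unique ((hasDerivAt_line hf v p).sub (hasDerivAt_line hg v p))

/-- Spatial covariant derivative of a function on spacetime. -/
def stCov (A : Fin n → ℝ × (Fin n → ℝ) → Mat k) (i : Fin n) (f : ℝ × (Fin n → ℝ) → Mat k)
    (p : ℝ × (Fin n → ℝ)) : Mat k :=
  dirD (spaceDir i) f p + mbra (A i p) (f p)

/-- Spatial curvature as a function on spacetime. -/
def stCurv (A : Fin n → ℝ × (Fin n → ℝ) → Mat k) (i j : Fin n) (p : ℝ × (Fin n → ℝ)) : Mat k :=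
  dirD (spaceDir i) (A j) p - dirD (spaceDir j) (A i) p + mbra (A i p) (A j p)

section Connection

variable {A : Fin n → ℝ × (Fin n → ℝ) → Mat k} (hA : ∀ i, ContDiff ℝ ∞ (A i))

include hA

lemma contDiff_stCurv (i j : Fin n) : ContDiff ℝ ∞ (stCurv A i j) :=
  ((contDiff_dirD (hA j) _).sub (contDiff_dirD (hA i) _)).add (contDiff_mbra (hA i) (hA j))

/-- The variation of curvature is the exterior covariant derivative of the variation. -/
lemma dirD_stCurv (v p : ℝ × (Fin n → ℝ)) (i j : Fin n) :
    dirD v (stCurv A i j) p = stCov A i (dirD v (A j)) p - stCov A j (dirD v (A i)) p := by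
  unfold stCurv
  rw [dirD_add ((contDiff_dirD (hA j) _).sub (contDiff_dirD (hA i) _))
      (contDiff_mbra (hA i) (hA j)),
    dirD_sub (contDiff_dirD (hA j) _) (contDiff_dirD (hA i) _), dirD_mbra (hA i) (hA j),
    dirD_comm (hA j) v, dirD_comm (hA i) v, mbra_skew (dirD v (A i) p)]
  simp only [stCov]
  abel

/-- The second Bianchi identity. -/
lemma stCov_stCurv_cyclic (p : ℝ × (Fin n → ℝ)) (m i j : Fin n) :
    stCov A m (stCurv A i j) p + stCov A i (stCurv A j m) p + stCov A j (stCurv A m i) p = 0 := by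
  have h : ∀ m i j, stCov A m (stCurv A i j) p =
      dirD (spaceDir m) (stCurv A i j) p + mbra (A m p) (stCurv A i j p) := fun _ _ _ => rfl
  simp only [h, dirD_stCurv hA]
  simp only [stCov, stCurv, mbra_add_right, mbra_sub_right]
  rw [dirD_comm (hA j) (spaceDir i) (spaceDir m), dirD_comm (hA i) (spaceDir j) (spaceDir m),
    dirD_comm (hA m) (spaceDir j) (spaceDir i)]
  rw [← mbra_jacobi (A m p) (A i p) (A j p)]
  abel

omit hA in
lemma dirD_minner_stCov (hskew : ∀ i p a b, A i p b a = -A i p a b)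
    {f g : ℝ × (Fin n → ℝ) → Mat k} (hf : ContDiff ℝ ∞ f) (hg : ContDiff ℝ ∞ g) (i : Fin n)
    (p : ℝ × (Fin n → ℝ)) :
    dirD (spaceDir i) (fun q => minner (f q) (g q)) p =
      minner (stCov A i f p) (g p) + minner (f p) (stCov A i g p) := by
  have h := minner_mbra (A i p) (f p) (g p) (hskew i p)
  rw [dirD_minner hf hg]
  simp only [stCov, minner_add_left, minner_add_right]
  linarith

omit hA in
lemma stCurv_antisymm (i j : Fin n) (p : ℝ × (Fin n → ℝ)) : stCurv A j i p = -stCurv A i j p := by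
  simp only [stCurv]
  rw [mbra_skew (A j p)]
  abel

lemma stCov_stCurv_antisymm (m i j : Fin n) (p : ℝ × (Fin n → ℝ)) :
    stCov A m (stCurv A j i) p = -stCov A m (stCurv A i j) p := by
  have h : dirD (spaceDir m) (stCurv A j i) p = -dirD (spaceDir m) (stCurv A i j) p := by
    rw [dirD_stCurv hA, dirD_stCurv hA, neg_sub]
  rw [stCov, stCov, h, stCurv_antisymm i j p, mbra_neg_right]
  abel

end Connection

end Calculus

section Integrals

variable {n : ℕ}

lemma integral_fderiv_eq_zero {V : (Fin n → ℝ) → ℝ} (hV : ContDiff ℝ 1 V)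
    (hc : HasCompactSupport V) (v : Fin n → ℝ) :
    Integrable (fun x => fderiv ℝ V x v) ∧ ∫ x, fderiv ℝ V x v = 0 := by
  have hi : Integrable (fun x => fderiv ℝ V x v) :=
    ((hV.continuous_fderiv (by simp)).clm_apply continuous_const).integrable_of_hasCompactSupport
      (hc.fderiv_apply ℝ v)
  refine ⟨hi, ?_⟩
  have h := integral_mul_fderiv_eq_neg_fderiv_mul_of_integrable (μ := volume) (𝕜 := ℝ) (f := V)
    (g := fun _ => (1 : ℝ)) (v := v) (by simpa using hi) (by simp)
    (by simpa using hV.continuous.integrable_of_hasCompactSupport hc)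
    (fun x _ => hV.differentiable (by simp) x) (fun x _ => differentiableAt_const _)
  simpa using h

/-- If `h` is differentiable in time with a jointly continuous time derivative supported in a
fixed compact set, and the derivative has nonpositive integral, then `∫ h t` is antitone. -/
lemma antitoneOn_integral_of_hasDerivAt {h h' : ℝ → (Fin n → ℝ) → ℝ} {a b : ℝ}
    {K : Set (Fin n → ℝ)} (hK : IsCompact K)
    (hd : ∀ t ∈ Ioo a b, ∀ x, HasDerivAt (h · x) (h' t x) t)
    (hc : ∀ t ∈ Ioo a b, Continuous (h t))
    (hc' : ContinuousOn (fun p : ℝ × (Fin n → ℝ) => h' p.1 p.2) (Ioo a b ×ˢ univ))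
    (hs : ∀ t ∈ Ioo a b, ∀ x ∉ K, h t x = 0) (hs' : ∀ t ∈ Ioo a b, ∀ x ∉ K, h' t x = 0)
    (hle : ∀ t ∈ Ioo a b, ∫ x, h' t x ≤ 0) :
    AntitoneOn (fun t => ∫ x, h t x) (Ioo a b) := by
  have key : ∀ t ∈ Ioo a b, HasDerivAt (fun t => ∫ x, h t x) (∫ x, h' t x) t := by
    intro t ht
    obtain ⟨ε, hε, hball⟩ := Metric.nhds_basis_closedBall.mem_iff.1 (isOpen_Ioo.mem_nhds ht)
    have hcpt : IsCompact (Metric.closedBall t ε ×ˢ K) := (isCompact_closedBall t ε).prod hK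
    obtain ⟨C, hC⟩ := hcpt.exists_bound_of_continuousOn
      (hc'.mono (prod_mono hball (subset_univ K)))
    refine (hasDerivAt_integral_of_dominated_loc_of_deriv_le (μ := volume)
      (bound := K.indicator fun _ => C) (F := h) (F' := h')
      (Metric.closedBall_mem_nhds t hε) ?_ ?_ ?_ ?_ ?_ ?_).2
    · filter_upwards [isOpen_Ioo.mem_nhds ht] with s hs
      exact (hc s hs).aestronglyMeasurable
    · exact (hc t ht).integrable_of_hasCompactSupport (HasCompactSupport.intro hK (hs t ht))
    · refine Continuous.aestronglyMeasurable (continuousOn_univ.1 ?_)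
      exact hc'.comp (f := fun x => (t, x)) (by fun_prop) fun x _ => ⟨ht, mem_univ x⟩
    · refine Eventually.of_forall fun x s hs => ?_
      by_cases hx : x ∈ K
      · rw [indicator_of_mem hx]
        exact hC (s, x) ⟨hs, hx⟩
      · rw [indicator_of_notMem hx, hs' s (hball hs) x hx, norm_zero]
    · exact (integrable_indicator_iff hK.measurableSet).2
        (integrableOn_const hK.measure_lt_top.ne)
    · exact Eventually.of_forall fun x s hs => hd s (hball hs) x
  refine antitoneOn_of_deriv_nonpos (convex_Ioo a b)
    (fun t ht => (key t ht).continuousAt.continuousWithinAt) ?_ ?_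
  · rw [interior_Ioo]
    exact fun t ht => (key t ht).differentiableAt.differentiableWithinAt
  · rw [interior_Ioo]
    intro t ht
    rw [(key t ht).deriv]
    exact hle t ht

lemma gauss_nonneg (x0 x : Fin n → ℝ) {t0 t : ℝ} (ht : t < t0) : 0 ≤ gauss (x0, t0) x t := by
  have : 0 < t0 - t := sub_pos.2 ht
  unfold gauss
  positivity

lemma contDiff_gauss (z0 : (Fin n → ℝ) × ℝ) (t : ℝ) : ContDiff ℝ ∞ (fun x => gauss z0 x t) := by
  unfold gauss
  fun_prop

lemma continuousOn_gauss (x0 : Fin n → ℝ) (t0 : ℝ) :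
    ContinuousOn (fun p : ℝ × (Fin n → ℝ) => gauss (x0, t0) p.2 p.1) (Iio t0 ×ˢ univ) := by
  unfold gauss
  have h : ∀ p ∈ Iio t0 ×ˢ (univ : Set (Fin n → ℝ)), 0 < t0 - p.1 := fun p hp => sub_pos.2 hp.1
  refine ContinuousOn.mul (ContinuousOn.rpow_const (by fun_prop) fun p hp => Or.inl ?_)
    (ContinuousOn.rexp (ContinuousOn.div (by fun_prop) (by fun_prop) fun p hp => ?_))
  · have := h p hp
    positivity
  · have := h p hp
    positivity

/-- The backwards heat equation satisfied by the kernel, with the Laplacian evaluated. -/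
lemma hasDerivAt_gauss_time (x0 x : Fin n → ℝ) {t0 t : ℝ} (ht : t < t0) :
    HasDerivAt (fun s => gauss (x0, t0) x s)
      ((n / (2 * (t0 - t)) - (∑ i, (x i - x0 i) ^ 2) / (4 * (t0 - t) ^ 2))
        * gauss (x0, t0) x t) t := by
  have hs : 0 < t0 - t := sub_pos.2 ht
  have h0 : HasDerivAt (fun s => t0 - s) (-1) t := by
    simpa using (hasDerivAt_id t).const_sub t0
  have hb : 0 < 4 * Real.pi * (t0 - t) := by positivity
  have h1 := (h0.const_mul (4 * Real.pi)).rpow_const (p := -(n : ℝ) / 2) (Or.inl hb.ne')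
  have h2 := ((h0.const_mul 4).fun_inv (by positivity)).const_mul (-∑ i, (x i - x0 i) ^ 2)
  have h3 := h1.mul h2.exp
  unfold gauss
  simp only [div_eq_mul_inv (-∑ i, (x i - x0 i) ^ 2)]
  refine h3.congr_deriv ?_
  rw [Real.rpow_sub_one hb.ne']
  have hpi := Real.pi_pos.ne'
  field_simp
  ring

lemma hasDerivAt_gauss_space (x0 x : Fin n → ℝ) {t0 t : ℝ} (ht : t < t0) (i : Fin n) :
    HasDerivAt (fun τ : ℝ => gauss (x0, t0) (x + τ • Pi.single i 1) t)
      (-((x i - x0 i) / (2 * (t0 - t)) * gauss (x0, t0) x t)) 0 := by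
  have hs : 0 < t0 - t := sub_pos.2 ht
  have h0 : HasDerivAt (fun τ : ℝ => ∑ m, ((x + τ • Pi.single i 1 : Fin n → ℝ) m - x0 m) ^ 2)
      (2 * (x i - x0 i)) 0 := by
    have h1 : ∀ m : Fin n, HasDerivAt
        (fun τ : ℝ => ((x + τ • Pi.single i 1 : Fin n → ℝ) m - x0 m) ^ 2)
        (2 * (x m - x0 m) * (Pi.single i 1 : Fin n → ℝ) m) 0 := by
      intro m
      have h2 : HasDerivAt (fun τ : ℝ => (x + τ • Pi.single i 1 : Fin n → ℝ) m - x0 m)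
          ((Pi.single i 1 : Fin n → ℝ) m) 0 := by
        simpa using (((hasDerivAt_id (0 : ℝ)).mul_const
          ((Pi.single i 1 : Fin n → ℝ) m)).const_add (x m)).sub_const (x0 m)
      simpa using h2.fun_pow 2
    refine (HasDerivAt.fun_sum fun m _ => h1 m).congr_deriv ?_
    simp [Pi.single_apply]
  have h3 := ((h0.fun_neg.div_const (4 * (t0 - t))).exp).const_mul
    ((4 * Real.pi * (t0 - t)) ^ (-(n : ℝ) / 2))
  unfold gauss
  refine h3.congr_deriv ?_
  simp only [zero_smul, add_zero]
  field_simp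
  ring

end Integrals

section Monotonicity

variable {n k : ℕ}

/-- The energy density `|F|²` as a function on spacetime. -/
def stEnergy (A : Fin n → ℝ × (Fin n → ℝ) → Mat k) (p : ℝ × (Fin n → ℝ)) : ℝ :=
  ∑ i, ∑ j, msq (stCurv A i j p)

/-- The vector field whose divergence appears in the derivative of the entropy, without the
weight. -/
def entropyField (A : Fin n → ℝ × (Fin n → ℝ) → Mat k) (x0 : Fin n → ℝ) (s : ℝ) (i : Fin n)
    (p : ℝ × (Fin n → ℝ)) : ℝ :=
  4 * s ^ 2 * (∑ j, minner (stCurv A i j p) (dirD (timeDir n) (A j) p))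
    + s / 2 * ((p.2 i - x0 i) * stEnergy A p)
    - 2 * s * ∑ m, (p.2 m - x0 m) * ∑ j, minner (stCurv A m j p) (stCurv A i j p)

variable {A : Fin n → ℝ × (Fin n → ℝ) → Mat k}

lemma contDiff_stEnergy (hA : ∀ i, ContDiff ℝ ∞ (A i)) : ContDiff ℝ ∞ (stEnergy A) :=
  ContDiff.sum fun i _ => ContDiff.sum fun j _ =>
    contDiff_minner (contDiff_stCurv hA i j) (contDiff_stCurv hA i j)

lemma contDiff_entropyField (hA : ∀ i, ContDiff ℝ ∞ (A i)) (x0 : Fin n → ℝ) (s : ℝ) (i : Fin n) :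
    ContDiff ℝ ∞ (entropyField A x0 s i) := by
  have h1 : ∀ m j, ContDiff ℝ ∞ (fun p => minner (stCurv A m j p) (stCurv A i j p)) := fun m j =>
    contDiff_minner (contDiff_stCurv hA m j) (contDiff_stCurv hA i j)
  have h2 : ∀ j, ContDiff ℝ ∞ (fun p => minner (stCurv A i j p) (dirD (timeDir n) (A j) p)) :=
    fun j => contDiff_minner (contDiff_stCurv hA i j) (contDiff_dirD (hA j) _)
  have h3 := contDiff_stEnergy hA
  have hy : ∀ m, ContDiff ℝ ∞ (fun p : ℝ × (Fin n → ℝ) => p.2 m - x0 m) := fun m => by fun_prop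
  exact ((contDiff_const.mul (ContDiff.sum fun j _ => h2 j)).add
    (contDiff_const.mul ((hy i).mul h3))).sub
      (contDiff_const.mul (ContDiff.sum fun m _ => (hy m).mul (ContDiff.sum fun j _ => h1 m j)))

lemma hasDerivAt_stEnergy_time (hA : ∀ i, ContDiff ℝ ∞ (A i)) (t : ℝ) (x : Fin n → ℝ) :
    HasDerivAt (fun s => stEnergy A (s, x))
      (2 * ∑ i, ∑ j, minner (stCurv A i j (t, x))
        (stCov A i (dirD (timeDir n) (A j)) (t, x)
          - stCov A j (dirD (timeDir n) (A i)) (t, x))) t := by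
  simp only [Finset.mul_sum]
  refine HasDerivAt.fun_sum fun i _ => HasDerivAt.fun_sum fun j _ => ?_
  have h := hasDerivAt_time (contDiff_stCurv hA i j) t x
  rw [dirD_stCurv hA] at h
  refine (h.minner h).congr_deriv ?_
  rw [minner_comm _ (stCurv A i j (t, x))]
  ring

lemma hasDerivAt_minner_space (hskew : ∀ i p a b, A i p b a = -A i p a b)
    {f g : ℝ × (Fin n → ℝ) → Mat k} (hf : ContDiff ℝ ∞ f) (hg : ContDiff ℝ ∞ g) (i : Fin n)
    (t : ℝ) (x : Fin n → ℝ) :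
    HasDerivAt (fun τ : ℝ => minner (f (t, x + τ • Pi.single i 1)) (g (t, x + τ • Pi.single i 1)))
      (minner (stCov A i f (t, x)) (g (t, x)) + minner (f (t, x)) (stCov A i g (t, x))) 0 := by
  rw [← dirD_minner_stCov hskew hf hg]
  exact hasDerivAt_space (contDiff_minner hf hg) t x i

lemma hasDerivAt_stEnergy_space (hA : ∀ i, ContDiff ℝ ∞ (A i))
    (hskew : ∀ i p a b, A i p b a = -A i p a b) (i : Fin n) (t : ℝ) (x : Fin n → ℝ) :
    HasDerivAt (fun τ : ℝ => stEnergy A (t, x + τ • Pi.single i 1))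
      (∑ a, ∑ b, 2 * minner (stCov A i (stCurv A a b) (t, x)) (stCurv A a b (t, x))) 0 := by
  refine HasDerivAt.fun_sum fun a _ => HasDerivAt.fun_sum fun b _ => ?_
  refine (hasDerivAt_minner_space hskew (contDiff_stCurv hA a b) (contDiff_stCurv hA a b)
    i t x).congr_deriv ?_
  rw [minner_comm (stCurv A a b (t, x))]
  ring

lemma hasDerivAt_entropyField (hA : ∀ i, ContDiff ℝ ∞ (A i))
    (hskew : ∀ i p a b, A i p b a = -A i p a b) (x0 : Fin n → ℝ) (s : ℝ) (i : Fin n) (t : ℝ)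
    (x : Fin n → ℝ) :
    HasDerivAt (fun τ : ℝ => entropyField A x0 s i (t, x + τ • Pi.single i 1))
      (4 * s ^ 2 * (∑ j, (minner (stCov A i (stCurv A i j) (t, x)) (dirD (timeDir n) (A j) (t, x))
          + minner (stCurv A i j (t, x)) (stCov A i (dirD (timeDir n) (A j)) (t, x))))
        + s / 2 * (∑ a, ∑ b, msq (stCurv A a b (t, x))
          + (x i - x0 i) * ∑ a, ∑ b,
            2 * minner (stCov A i (stCurv A a b) (t, x)) (stCurv A a b (t, x)))
        - 2 * s * (∑ j, msq (stCurv A i j (t, x))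
          + ∑ m, (x m - x0 m) * ∑ j,
            (minner (stCov A i (stCurv A m j) (t, x)) (stCurv A i j (t, x))
              + minner (stCurv A m j (t, x)) (stCov A i (stCurv A i j) (t, x))))) 0 := by
  have hy : ∀ m : Fin n, HasDerivAt (fun τ : ℝ => (x + τ • Pi.single i 1 : Fin n → ℝ) m - x0 m)
      ((Pi.single i 1 : Fin n → ℝ) m) 0 := by
    intro m
    simpa using (((hasDerivAt_id (0 : ℝ)).mul_const
      ((Pi.single i 1 : Fin n → ℝ) m)).const_add (x m)).sub_const (x0 m)
  have h1 := HasDerivAt.fun_sum (u := Finset.univ) fun j _ => hasDerivAt_minner_space hskew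
    (contDiff_stCurv hA i j) (contDiff_dirD (hA j) (timeDir n)) i t x
  have h2 := (hy i).mul (hasDerivAt_stEnergy_space hA hskew i t x)
  have h3 := HasDerivAt.fun_sum (u := Finset.univ) fun m _ => (hy m).mul
    (HasDerivAt.fun_sum (u := Finset.univ) fun j _ => hasDerivAt_minner_space hskew
      (contDiff_stCurv hA m j) (contDiff_stCurv hA i j) i t x)
  refine (((h1.const_mul (4 * s ^ 2)).add (h2.const_mul (s / 2))).sub
    (h3.const_mul (2 * s))).congr_deriv ?_
  simp only [zero_smul, add_zero, Finset.sum_add_distrib, Pi.single_apply, ite_mul, one_mul,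
    zero_mul, Finset.sum_ite_eq', Finset.mem_univ, if_true, stEnergy, msq]

section Support

variable {K : Set (Fin n → ℝ)} (hK : IsClosed K) (hsupp : ∀ i t, ∀ x ∉ K, A i (t, x) = 0)

include hK

lemma dirD_eq_zero_of_notMem {f : ℝ × (Fin n → ℝ) → Mat k} (hf : ∀ t, ∀ x ∉ K, f (t, x) = 0)
    (v : ℝ × (Fin n → ℝ)) (t : ℝ) {x : Fin n → ℝ} (hx : x ∉ K) : dirD v f (t, x) = 0 := by
  have h : f =ᶠ[nhds (t, x)] fun _ => 0 := by
    filter_upwards [(hK.isOpen_compl.preimage continuous_snd).mem_nhds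
      (show (t, x) ∈ Prod.snd ⁻¹' Kᶜ from hx)] with p hp
    exact hf p.1 p.2 hp
  rw [dirD, h.fderiv_eq]
  simp

include hsupp

lemma stCurv_eq_zero_of_notMem (i j : Fin n) (t : ℝ) {x : Fin n → ℝ} (hx : x ∉ K) :
    stCurv A i j (t, x) = 0 := by
  rw [stCurv, dirD_eq_zero_of_notMem hK (hsupp j) _ t hx,
    dirD_eq_zero_of_notMem hK (hsupp i) _ t hx, hsupp j t x hx, mbra_zero_right]
  simp

lemma stEnergy_eq_zero_of_notMem (t : ℝ) {x : Fin n → ℝ} (hx : x ∉ K) :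
    stEnergy A (t, x) = 0 := by
  simp [stEnergy, msq, stCurv_eq_zero_of_notMem hK hsupp _ _ t hx, minner_zero_left]

lemma entropyField_eq_zero_of_notMem (x0 : Fin n → ℝ) (s : ℝ) (i : Fin n) (t : ℝ)
    {x : Fin n → ℝ} (hx : x ∉ K) : entropyField A x0 s i (t, x) = 0 := by
  simp [entropyField, stEnergy_eq_zero_of_notMem hK hsupp t hx,
    stCurv_eq_zero_of_notMem hK hsupp _ _ t hx, minner_zero_left]

end Support

/-- Along the flow the Gaussian-weighted energy is antitone in time. -/
lemma antitoneOn_weighted_energy (hA : ∀ i, ContDiff ℝ ∞ (A i))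
    (hskew : ∀ i p a b, A i p b a = -A i p a b) {K : Set (Fin n → ℝ)} (hK : IsCompact K)
    (hsupp : ∀ i t, ∀ x ∉ K, A i (t, x) = 0) (x0 : Fin n → ℝ) {t0 : ℝ}
    (hflow : ∀ t ∈ Ioo 0 t0, ∀ x j,
      dirD (timeDir n) (A j) (t, x) = ∑ i, stCov A i (stCurv A i j) (t, x)) :
    AntitoneOn (fun t => ∫ x, (t0 - t) ^ 2 * stEnergy A (t, x) * gauss (x0, t0) x t)
      (Ioo 0 t0) := by
  have hE := contDiff_stEnergy hA
  have hE0 := fun t x (hx : x ∉ K) => stEnergy_eq_zero_of_notMem hK.isClosed hsupp t hx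
  let E' : ℝ × (Fin n → ℝ) → ℝ := dirD (timeDir n) (stEnergy A)
  have hE' : Continuous E' := (contDiff_dirD hE _).continuous
  have hE'0 : ∀ t, ∀ x ∉ K, E' (t, x) = 0 := by
    intro t x hx
    have h := hasDerivAt_time hE t x
    simp only [hE0 _ x hx] at h
    exact h.unique (hasDerivAt_const t 0)
  let h' : ℝ → (Fin n → ℝ) → ℝ := fun t x =>
    (-2 * (t0 - t) * stEnergy A (t, x) + (t0 - t) ^ 2 * (E' (t, x) + stEnergy A (t, x)
      * (n / (2 * (t0 - t)) - (∑ i, (x i - x0 i) ^ 2) / (4 * (t0 - t) ^ 2))))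
      * gauss (x0, t0) x t
  have hsub : Ioo 0 t0 ×ˢ (univ : Set (Fin n → ℝ)) ⊆ Iio t0 ×ˢ univ :=
    prod_mono Ioo_subset_Iio_self subset_rfl
  have hcont : ContinuousOn (fun p : ℝ × (Fin n → ℝ) => h' p.1 p.2) (Ioo 0 t0 ×ˢ univ) := by
    have hEc := hE.continuous
    refine ContinuousOn.mul ?_ ((continuousOn_gauss x0 t0).mono hsub)
    have hne : ∀ p ∈ Ioo 0 t0 ×ˢ (univ : Set (Fin n → ℝ)), t0 - p.1 ≠ 0 := fun p hp =>
      (sub_pos.2 hp.1.2).ne'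
    have h1 : ContinuousOn (fun p : ℝ × (Fin n → ℝ) => (n : ℝ) / (2 * (t0 - p.1)))
        (Ioo 0 t0 ×ˢ univ) :=
      ContinuousOn.div (by fun_prop) (by fun_prop) fun p hp => by simpa using hne p hp
    have h2 : ContinuousOn (fun p : ℝ × (Fin n → ℝ) =>
        (∑ i, (p.2 i - x0 i) ^ 2) / (4 * (t0 - p.1) ^ 2)) (Ioo 0 t0 ×ˢ univ) :=
      ContinuousOn.div (by fun_prop) (by fun_prop) fun p hp => by simpa using hne p hp
    fun_prop
  refine antitoneOn_integral_of_hasDerivAt (h' := h') hK ?_ ?_ hcont ?_ ?_ ?_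
  · intro t ht x
    have h0 : HasDerivAt (fun s => t0 - s) (-1) t := by
      simpa using (hasDerivAt_id t).const_sub t0
    refine (((h0.fun_pow 2).fun_mul (hasDerivAt_time hE t x)).fun_mul
      (hasDerivAt_gauss_time x0 x ht.2)).congr_deriv ?_
    simp only [h', E']
    push_cast
    ring
  · intro t _
    have h1 := (contDiff_gauss (x0, t0) t).continuous
    have h2 := hE.continuous
    fun_prop
  · intro t _ x hx
    rw [hE0 t x hx]
    ring
  · intro t _ x hx
    simp only [h', hE0 t x hx, hE'0 t x hx]
    ring
  · intro t ht
    have hs : 0 < t0 - t := sub_pos.2 ht.2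
    set s := t0 - t with hs_def
    let V : Fin n → (Fin n → ℝ) → ℝ := fun i x =>
      entropyField A x0 s i (t, x) * gauss (x0, t0) x t
    have hV : ∀ i, ContDiff ℝ ∞ (V i) := fun i =>
      ((contDiff_entropyField hA x0 s i).comp (contDiff_prodMk_right t)).mul
        (contDiff_gauss (x0, t0) t)
    have hVint := fun i => integral_fderiv_eq_zero ((hV i).of_le (by simp))
      (HasCompactSupport.intro hK fun x hx => by
        simp only [V, entropyField_eq_zero_of_notMem hK.isClosed hsupp x0 s i t hx, zero_mul])
      (Pi.single i 1)
    have hVd : ∀ i x, fderiv ℝ (V i) x (Pi.single i 1) = _ := fun i x =>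
      (((hV i).differentiable (by simp) x).hasFDerivAt.hasLineDerivAt (Pi.single i 1)).unique
        ((hasDerivAt_entropyField hA hskew x0 s i t x).fun_mul
          (hasDerivAt_gauss_space x0 x ht.2 i))
    have hpt : ∀ x, h' t x = ∑ i, fderiv ℝ (V i) x (Pi.single i 1)
        - s ^ 2 * (∑ j, msq ((2 : ℝ) • dirD (timeDir n) (A j) (t, x)
          - s⁻¹ • ∑ i, (x i - x0 i) • stCurv A i j (t, x))) * gauss (x0, t0) x t := by
      intro x
      have hid := energy_density_identity (fun i j => stCurv A i j (t, x))
        (fun i j => stCov A i (dirD (timeDir n) (A j)) (t, x))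
        (fun m i j => stCov A m (stCurv A i j) (t, x))
        (fun j => dirD (timeDir n) (A j) (t, x)) (fun i => x i - x0 i) s hs.ne'
        (fun i j => stCurv_antisymm i j _) (fun m i j => stCov_stCurv_antisymm hA _ _ _ _)
        (fun m i j => stCov_stCurv_cyclic hA _ _ _ _) (hflow t ht x)
      have hE'x : E' (t, x) = _ :=
        (hasDerivAt_time hE t x).unique (hasDerivAt_stEnergy_time hA t x)
      simp only [h', ← hs_def, hVd, hE'x, zero_smul, add_zero]
      have hG : ∀ a b c g : ℝ, a * g + b * -(c * g) = (a - c * b) * g := fun a b c g => by ring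
      simp only [hG, ← Finset.sum_mul]
      rw [← sub_mul]
      congr 1
    have hsum : Integrable (fun x => ∑ i, fderiv ℝ (V i) x (Pi.single i 1)) :=
      integrable_finsetSum _ fun i _ => (hVint i).1
    have hsum0 : ∫ x, ∑ i, fderiv ℝ (V i) x (Pi.single i 1) = 0 := by
      rw [integral_finsetSum _ fun i _ => (hVint i).1]
      exact Finset.sum_eq_zero fun i _ => (hVint i).2
    have hint : Integrable (h' t) := by
      refine Continuous.integrable_of_hasCompactSupport (continuousOn_univ.1 ?_)
        (HasCompactSupport.intro hK fun x hx => ?_)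
      · exact hcont.comp (f := fun x => (t, x)) (by fun_prop) fun x _ => ⟨ht, mem_univ x⟩
      · simp only [h', hE0 t x hx, hE'0 t x hx]
        ring
    suffices hkey : ∫ x, (h' t x - ∑ i, fderiv ℝ (V i) x (Pi.single i 1)) ≤ 0 by
      rwa [integral_sub hint hsum, hsum0, sub_zero] at hkey
    refine integral_nonpos fun x => ?_
    have hg := gauss_nonneg x0 x ht.2
    have hm : 0 ≤ ∑ j, msq ((2 : ℝ) • dirD (timeDir n) (A j) (t, x)
        - s⁻¹ • ∑ i, (x i - x0 i) • stCurv A i j (t, x)) :=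
      Finset.sum_nonneg fun j _ => msq_nonneg _
    have := mul_nonneg (mul_nonneg (sq_nonneg s) hm) hg
    simp only [Pi.zero_apply, hpt x]
    linarith

end Monotonicity

/-- Monotonicity of the entropy `Φ` along Yang–Mills flow on `ℝⁿ`:
for `0 < ρ ≤ r < √t₀/2` one has `Φ_{z₀}(ρ;Γ) ≤ Φ_{z₀}(r;Γ)`. -/
theorem entropy_Phi_monotonicity
    (n k : ℕ) (hn : 2 ≤ n) (hk : 1 ≤ k) (T : ℝ)
    (Γ : Conn n k) (hsm : IsSmoothConn Γ) (hflow : IsYMFlowOn Γ (Ico 0 T))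
    (K : Set (Fin n → ℝ)) (hK : IsCompact K) (hsupp : SuppIn Γ K)
    (x0 : Fin n → ℝ) (t0 : ℝ) (ht0 : t0 ∈ Ioo 0 T)
    (ρ r : ℝ) (hρ : 0 < ρ) (hρr : ρ ≤ r) (hr : r < Real.sqrt t0 / 2) :
    Phi Γ (x0, t0) ρ ≤ Phi Γ (x0, t0) r := by
  set A : Fin n → ℝ × (Fin n → ℝ) → Mat k := fun i p => Γ p.1 p.2 i with hA_def
  have hA : ∀ i, ContDiff ℝ ∞ (A i) := fun i => contDiff_pi.1 hsm.1 i
  have hcurv : ∀ t x i j, curv Γ t x i j = stCurv A i j (t, x) := by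
    intro t x i j
    rw [curv, stCurv, ← pd_slice (hA j), ← pd_slice (hA i)]
  have hanti := antitoneOn_weighted_energy hA (fun i p => hsm.2 p.1 p.2 i) hK
    (fun i t x hx => congrFun (hsupp t x hx) i) x0 (t0 := t0) (by
      intro t ht x j
      have h := hflow t ⟨ht.1.le, ht.2.trans ht0.2⟩ x j
      rw [tderiv, (hasDerivAt_time (hA j) t x).deriv] at h
      rw [h]
      refine Finset.sum_congr rfl fun i _ => ?_
      simp only [covD, stCov, hcurv]
      rw [pd_slice (contDiff_stCurv hA i j)])
  have hPhi : ∀ R, Phi Γ (x0, t0) R = 1 / 2 * ∫ x, (t0 - (t0 - R ^ 2)) ^ 2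
      * stEnergy A (t0 - R ^ 2, x) * gauss (x0, t0) x (t0 - R ^ 2) := by
    intro R
    simp only [Phi, normF2, hcurv, mul_assoc, integral_const_mul, stEnergy]
    ring
  have hr2 : r ^ 2 < t0 := by
    have h1 : r < Real.sqrt t0 := by linarith [Real.sqrt_nonneg t0]
    calc r ^ 2 < Real.sqrt t0 ^ 2 := pow_lt_pow_left₀ h1 (hρ.le.trans hρr) two_ne_zero
      _ = t0 := Real.sq_sqrt ht0.1.le
  have hρr2 : ρ ^ 2 ≤ r ^ 2 := pow_le_pow_left₀ hρ.le hρr 2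
  have hρ2 : 0 < ρ ^ 2 := by positivity
  rw [hPhi, hPhi]
  have h := hanti (a := t0 - r ^ 2) (b := t0 - ρ ^ 2) ⟨by linarith, by linarith⟩
    ⟨by linarith, by linarith⟩ (by linarith)
  simp only at h
  linarith

end
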